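/- Let d ≥ 3 and m ≥ 0, n = d + m(d−2), and let M_T be the matrix of d-path numbers associated to a d-angulation T of the convex n-gon. Then the Smith normal form of M_T over ℤ has elementary divisor d−1 with multiplicity m+1 and all remaining elementary divisors equal to 1, independently of the particular d-angulation T. -/

import Mathlib

noncomputable section

/-- The `k`-th vertex of a regular `n`-gon inscribed in the unit circle. -/
def vtx (n : ℕ) (k : ZMod n) : ℝ × ℝ :=
  (Real.cos (2 * Real.pi * k.val / n), Real.sin (2 * Real.pi * k.val / n))

/-- The convex hull spanned by a set `c` of vertices of the `n`-gon. -/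
def cellHull (n : ℕ) (c : Finset (ZMod n)) : Set (ℝ × ℝ) :=
  convexHull ℝ (vtx n '' (c : Set (ZMod n)))

/-- `T` is a `d`-angulation of the convex `n`-gon: a dissection of the polygon by
pairwise non-crossing diagonals into `d`-gon cells.  Each cell is recorded by its
vertex set; the cells cover the polygon and have pairwise disjoint interiors. -/
def IsDAngulation (n d : ℕ) (T : Finset (Finset (ZMod n))) : Prop :=
  (∀ c ∈ T, c.card = d) ∧
  (⋃ c ∈ T, cellHull n c) = convexHull ℝ (Set.range (vtx n)) ∧
  ∀ c ∈ T, ∀ c' ∈ T, c ≠ c' →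
    interior (cellHull n c) ∩ interior (cellHull n c') = ∅

/-- The number of vertices strictly between `i` and `j`, going counterclockwise. -/
def pathLen (n : ℕ) (i j : ZMod n) : ℕ := (j - i - 1).val

/-- A (counterclockwise) `d`-path from `i` to `j` in the `d`-angulation `T`:
a sequence `p_{i+1}, …, p_{j-1}` of cells of `T`, indexed by the vertices
encountered going counterclockwise from `i` to `j`, such that the cell at
position `k` is incident to the vertex `i+1+k`, and each cell of `T` occurs
at most `d - 2` times in the sequence. -/
def IsDPath (n d : ℕ) (T : Finset (Finset (ZMod n))) (i j : ZMod n)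
    (q : Fin (pathLen n i j) → {c // c ∈ T}) : Prop :=
  (∀ k, (i + 1 + ((k : ℕ) : ZMod n)) ∈ (q k : Finset (ZMod n))) ∧
  ∀ c ∈ T, (Finset.univ.filter (fun k => (q k : Finset (ZMod n)) = c)).card ≤ d - 2

/-- The number `m_{i,j}` of counterclockwise `d`-paths from `i` to `j`. -/
def dPathCount (n d : ℕ) (T : Finset (Finset (ZMod n))) (i j : ZMod n) : ℕ :=
  Nat.card {q : Fin (pathLen n i j) → {c // c ∈ T} // IsDPath n d T i j q}

/-- Twice the signed area of the triangle `p q r`. -/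
def triDet (p q r : ℝ × ℝ) : ℝ :=
  (q.1 - p.1) * (r.2 - p.2) - (q.2 - p.2) * (r.1 - p.1)

lemma triDet_circle_pos {α β γ : ℝ} (h1 : α < β) (h2 : β < γ) (h3 : γ < α + 2 * Real.pi) :
    0 < triDet (Real.cos α, Real.sin α) (Real.cos β, Real.sin β) (Real.cos γ, Real.sin γ) := by
  obtain ⟨x, rfl⟩ : ∃ x, β = α + 2 * x := ⟨(β - α) / 2, by ring⟩
  obtain ⟨y, rfl⟩ : ∃ y, γ = α + 2 * x + 2 * y := ⟨(γ - (α + 2 * x)) / 2, by ring⟩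
  have hx : 0 < Real.sin x := Real.sin_pos_of_pos_of_lt_pi (by linarith) (by linarith)
  have hy : 0 < Real.sin y := Real.sin_pos_of_pos_of_lt_pi (by linarith) (by linarith)
  have hxy : 0 < Real.sin (x + y) := Real.sin_pos_of_pos_of_lt_pi (by linarith) (by linarith)
  have : triDet (Real.cos α, Real.sin α) (Real.cos (α + 2 * x), Real.sin (α + 2 * x))
      (Real.cos (α + 2 * x + 2 * y), Real.sin (α + 2 * x + 2 * y))
      = 4 * Real.sin x * Real.sin y * Real.sin (x + y) := by
    have e : α + 2 * x + 2 * y = α + 2 * (x + y) := by ring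
    have key : ∀ u v : ℝ, triDet (Real.cos α, Real.sin α)
        (Real.cos (α + u), Real.sin (α + u)) (Real.cos (α + v), Real.sin (α + v))
        = Real.sin u + Real.sin (v - u) - Real.sin v := by
      intro u v
      simp only [triDet, Real.cos_add, Real.sin_add, Real.sin_sub]
      linear_combination (Real.cos u * Real.sin v - Real.sin u * Real.cos v + Real.sin u
        - Real.sin v) * Real.sin_sq_add_cos_sq α
    rw [e, key, show 2 * (x + y) - 2 * x = 2 * y by ring, Real.sin_two_mul, Real.sin_two_mul,
      Real.sin_two_mul, Real.sin_add, Real.cos_add]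
    linear_combination (- 2 * Real.sin y * Real.cos y) * Real.sin_sq_add_cos_sq x +
      (- 2 * Real.sin x * Real.cos x) * Real.sin_sq_add_cos_sq y
  rw [this]
  positivity

lemma triDet_vtx_pos {n : ℕ} [NeZero n] {p q r : ZMod n} (h1 : p.val < q.val)
    (h2 : q.val < r.val) : 0 < triDet (vtx n p) (vtx n q) (vtx n r) := by
  have hn : (0 : ℝ) < n := by exact_mod_cast Nat.pos_of_ne_zero (NeZero.ne n)
  have hpi := Real.pi_pos
  apply triDet_circle_pos
  · gcongr
  · gcongr
  · have : (r.val : ℝ) < n := by exact_mod_cast ZMod.val_lt r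
    have h0 : (0 : ℝ) ≤ 2 * Real.pi * p.val / n := by positivity
    have h3 : 2 * Real.pi * r.val / n < 2 * Real.pi := by
      rw [div_lt_iff₀ hn]; gcongr
    linarith

lemma vtx_mem_of_mem_cellHull {n : ℕ} [NeZero n] {c : Finset (ZMod n)} {v : ZMod n}
    (h : vtx n v ∈ cellHull n c) : v ∈ c := by
  by_contra hv
  have hn : (0 : ℝ) < n := by exact_mod_cast Nat.pos_of_ne_zero (NeZero.ne n)
  let f : ℝ × ℝ →ₗ[ℝ] ℝ := (vtx n v).1 • LinearMap.fst ℝ ℝ ℝ + (vtx n v).2 • LinearMap.snd ℝ ℝ ℝ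
  have hsub : cellHull n c ⊆ {x | f x < 1} := by
    refine convexHull_min ?_ (convex_halfSpace_lt f.isLinear 1)
    rintro _ ⟨u, hu, rfl⟩
    have huv : u ≠ v := fun h => hv (h ▸ hu)
    have hlt : ∀ w : ZMod n, 2 * Real.pi * w.val / n < 2 * Real.pi := fun w => by
      have : (w.val : ℝ) < n := by exact_mod_cast ZMod.val_lt w
      have := Real.pi_pos
      rw [div_lt_iff₀ hn]; gcongr
    have h0 : ∀ w : ZMod n, 0 ≤ 2 * Real.pi * w.val / n := fun w => by positivity
    have : f (vtx n u) = Real.cos (2 * Real.pi * v.val / n - 2 * Real.pi * u.val / n) := by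
      simp [f, vtx, Real.cos_sub]
    rw [Set.mem_ofPred_eq, this]
    refine lt_of_le_of_ne (Real.cos_le_one _) fun hc => huv ?_
    rw [Real.cos_eq_one_iff_of_lt_of_lt (by linarith [hlt u, h0 v]) (by linarith [hlt v, h0 u]),
      sub_eq_zero, div_left_inj' hn.ne', mul_right_inj' (by positivity), Nat.cast_inj] at hc
    exact (ZMod.val_injective n hc).symm
  have := hsub h
  simp only [Set.mem_ofPred_eq, f, vtx, LinearMap.add_apply, LinearMap.smul_apply,
    LinearMap.fst_apply, LinearMap.snd_apply, smul_eq_mul] at this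
  nlinarith [Real.sin_sq_add_cos_sq (2 * Real.pi * v.val / n)]

lemma convex_triDet_nonneg (p q : ℝ × ℝ) : Convex ℝ {x | 0 ≤ triDet p q x} := by
  intro x hx y hy a b ha hb hab
  simp only [Set.mem_ofPred_eq] at hx hy ⊢
  have : triDet p q (a • x + b • y) = a * triDet p q x + b * triDet p q y := by
    obtain rfl : b = 1 - a := by linarith
    simp [triDet]; ring
  rw [this]
  positivity

lemma triDet_rotate (p q r : ℝ × ℝ) : triDet p q r = triDet q r p := by
  simp only [triDet]; ring

lemma triDet_vtx_nonneg {n : ℕ} [NeZero n] {p q r : ZMod n} (h1 : p.val ≤ q.val)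
    (h2 : q.val ≤ r.val) : 0 ≤ triDet (vtx n p) (vtx n q) (vtx n r) := by
  rcases h1.lt_or_eq with h1 | h1
  · rcases h2.lt_or_eq with h2 | h2
    · exact (triDet_vtx_pos h1 h2).le
    · rw [ZMod.val_injective n h2]; simp [triDet, mul_comm]
  · rw [ZMod.val_injective n h1]; simp [triDet]

/-- Near each vertex `v` other than the first and the last, the polygon is covered by cells; one of
them has vertices on both sides of `v` in the linear order. -/
lemma exists_cell_around {n d : ℕ} [NeZero n] {T : Finset (Finset (ZMod n))}
    (hT : IsDAngulation n d T) {z v l : ZMod n} (h0 : z.val = 0) (hl : l.val + 1 = n)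
    (h1 : z.val < v.val) (h2 : v.val < l.val) :
    ∃ c ∈ T, v ∈ c ∧ (∃ u ∈ c, u.val < v.val) ∧ ∃ w ∈ c, v.val < w.val := by
  by_contra! H
  have hpos := triDet_vtx_pos h1 h2
  have hcv : Continuous fun t : ℝ => vtx n v + t • (midpoint ℝ (vtx n z) (vtx n l) - vtx n v) := by
    fun_prop
  have ev : ∀ᶠ t in nhdsWithin (0 : ℝ) (Set.Ioi 0), ∀ c ∈ T,
      vtx n v + t • (midpoint ℝ (vtx n z) (vtx n l) - vtx n v) ∉ cellHull n c := by
    rw [Filter.eventually_all_finset]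
    intro c hc
    by_cases hv : v ∈ c
    · filter_upwards [self_mem_nhdsWithin] with t ht hmem
      have ht : 0 < t := ht
      by_cases hlow : ∃ u ∈ c, u.val < v.val
      · have hup := H c hc hv hlow
        have hsub : cellHull n c ⊆ {x | 0 ≤ triDet (vtx n v) (vtx n z) x} := by
          refine convexHull_min ?_ (convex_triDet_nonneg _ _)
          rintro _ ⟨u, hu, rfl⟩
          rw [Set.mem_ofPred_eq, triDet_rotate]
          exact triDet_vtx_nonneg (by omega) (hup u hu)
        have := hsub hmem
        rw [Set.mem_ofPred_eq] at this
        have e : triDet (vtx n v) (vtx n z)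
            (vtx n v + t • (midpoint ℝ (vtx n z) (vtx n l) - vtx n v))
            = - (t / 2) * triDet (vtx n z) (vtx n v) (vtx n l) := by
          simp [triDet, midpoint_eq_smul_add]; ring
        rw [e] at this
        nlinarith
      · push Not at hlow
        have hsub : cellHull n c ⊆ {x | 0 ≤ triDet (vtx n l) (vtx n v) x} := by
          refine convexHull_min ?_ (convex_triDet_nonneg _ _)
          rintro _ ⟨u, hu, rfl⟩
          rw [Set.mem_ofPred_eq, triDet_rotate]
          refine triDet_vtx_nonneg (hlow u hu) ?_
          have := ZMod.val_lt u
          omega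
        have := hsub hmem
        rw [Set.mem_ofPred_eq] at this
        have e : triDet (vtx n l) (vtx n v)
            (vtx n v + t • (midpoint ℝ (vtx n z) (vtx n l) - vtx n v))
            = - (t / 2) * triDet (vtx n z) (vtx n v) (vtx n l) := by
          simp [triDet, midpoint_eq_smul_add]; ring
        rw [e] at this
        nlinarith
    · have hclosed : IsClosed (cellHull n c) :=
        ((c.finite_toSet.image (vtx n)).isCompact_convexHull ℝ).isClosed
      have hnot : vtx n v ∉ cellHull n c := fun h => hv (vtx_mem_of_mem_cellHull h)
      have := hcv.tendsto 0
      simp only [zero_smul, add_zero] at this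
      exact (this.mono_left nhdsWithin_le_nhds).eventually (hclosed.isOpen_compl.mem_nhds hnot)
  have ev1 : ∀ᶠ t in nhdsWithin (0 : ℝ) (Set.Ioi 0), t ∈ Set.Ioo (0 : ℝ) 1 :=
    Ioo_mem_nhdsGT one_pos
  obtain ⟨t, ht, ht1⟩ := (ev.and ev1).exists
  have hcx := convex_convexHull ℝ (Set.range (vtx n))
  have hmem : ∀ u, vtx n u ∈ convexHull ℝ (Set.range (vtx n)) :=
    fun u => subset_convexHull _ _ ⟨u, rfl⟩
  have hin : vtx n v + t • (midpoint ℝ (vtx n z) (vtx n l) - vtx n v)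
      ∈ convexHull ℝ (Set.range (vtx n)) :=
    hcx.add_smul_sub_mem (hmem v) (hcx.midpoint_mem (hmem z) (hmem l)) ⟨ht1.1.le, ht1.2.le⟩
  rw [← hT.2.1] at hin
  simp only [Set.mem_iUnion] at hin
  obtain ⟨c, hc, h⟩ := hin
  exact ht c hc h

lemma interior_cellHull_nonempty {n : ℕ} [NeZero n] {c : Finset (ZMod n)} (hc : 3 ≤ c.card) :
    (interior (cellHull n c)).Nonempty := by
  obtain ⟨p, q, r, hp, hq, hr, hpq, hqr⟩ : ∃ p q r, p ∈ c ∧ q ∈ c ∧ r ∈ c ∧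
      p.val < q.val ∧ q.val < r.val := by
    have hcard : (c.image ZMod.val).card = c.card :=
      Finset.card_image_of_injective _ (ZMod.val_injective n)
    let o := (c.image ZMod.val).orderEmbOfFin hcard
    have ho : ∀ i, ∃ x ∈ c, x.val = o i := fun i =>
      Finset.mem_image.1 (Finset.orderEmbOfFin_mem _ hcard i)
    obtain ⟨p, hp, hp'⟩ := ho ⟨0, by omega⟩
    obtain ⟨q, hq, hq'⟩ := ho ⟨1, by omega⟩
    obtain ⟨r, hr, hr'⟩ := ho ⟨2, by omega⟩
    refine ⟨p, q, r, hp, hq, hr, ?_, ?_⟩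
    · rw [hp', hq']; exact o.strictMono (by simp)
    · rw [hq', hr']; exact o.strictMono (by simp)
  have hpos := triDet_vtx_pos hpq hqr
  have hD := hpos.ne'
  rw [cellHull, interior_convexHull_nonempty_iff_affineSpan_eq_top, eq_top_iff]
  intro x _
  set S := affineSpan ℝ (vtx n '' (c : Set (ZMod n)))
  have hmem : ∀ u ∈ c, vtx n u ∈ S := fun u hu => subset_affineSpan _ _ ⟨u, hu, rfl⟩
  have h1 := AffineSubspace.vsub_mem_direction (hmem q hq) (hmem p hp)
  have h2 := AffineSubspace.vsub_mem_direction (hmem r hr) (hmem p hp)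
  have h3 := S.direction.add_mem
    (S.direction.smul_mem (triDet (vtx n p) x (vtx n r) / triDet (vtx n p) (vtx n q) (vtx n r)) h1)
    (S.direction.smul_mem (triDet (vtx n p) (vtx n q) x / triDet (vtx n p) (vtx n q) (vtx n r)) h2)
  have h4 := AffineSubspace.vadd_mem_of_mem_direction h3 (hmem p hp)
  convert h4 using 1
  ext
  · simp only [vsub_eq_sub, vadd_eq_add, Prod.fst_add, Prod.smul_fst, Prod.fst_sub, smul_eq_mul]
    field_simp
    simp only [triDet]; ring
  · simp only [vsub_eq_sub, vadd_eq_add, Prod.snd_add, Prod.smul_snd, Prod.snd_sub, smul_eq_mul]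
    field_simp
    simp only [triDet]; ring

lemma not_crossing {n d : ℕ} [NeZero n] (hd : 3 ≤ d) {T : Finset (Finset (ZMod n))}
    (hT : IsDAngulation n d T) {c c' : Finset (ZMod n)} (hc : c ∈ T) (hc' : c' ∈ T)
    (hne : c ≠ c') {p q r s : ZMod n} (hp : p ∈ c) (hq : q ∈ c') (hr : r ∈ c) (hs : s ∈ c')
    (hpq : p.val < q.val) (hqr : q.val < r.val) (hrs : r.val < s.val) : False := by
  have hinterior := interior_cellHull_nonempty (n := n) (hd.trans_eq (hT.1 c hc).symm)
  have hinterior' := interior_cellHull_nonempty (n := n) (hd.trans_eq (hT.1 c' hc').symm)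
  have hconv : ∀ c, Convex ℝ (cellHull n c) := fun c => convex_convexHull ℝ _
  obtain ⟨f, u, hf, hf'⟩ := geometric_hahn_banach_open_open (hconv c).interior isOpen_interior
    (hconv c').interior isOpen_interior
    (Set.disjoint_iff_inter_eq_empty.2 (hT.2.2 c hc c' hc' hne))
  have hmem : ∀ {c} {v}, v ∈ c → vtx n v ∈ cellHull n c := fun hv =>
    subset_convexHull _ _ ⟨_, hv, rfl⟩
  have hle : ∀ v ∈ c, f (vtx n v) ≤ u := fun v hv => by
    have h1 : vtx n v ∈ closure (interior (cellHull n c)) := by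
      rw [(hconv c).closure_interior_eq_closure_of_nonempty_interior hinterior]
      exact subset_closure (hmem hv)
    exact closure_minimal (fun x hx => (hf x hx).le)
      (isClosed_le f.continuous continuous_const) h1
  have hge : ∀ v ∈ c', u ≤ f (vtx n v) := fun v hv => by
    have h1 : vtx n v ∈ closure (interior (cellHull n c')) := by
      rw [(hconv c').closure_interior_eq_closure_of_nonempty_interior hinterior']
      exact subset_closure (hmem hv)
    exact closure_minimal (fun x hx => (hf' x hx).le)
      (isClosed_le continuous_const f.continuous) h1
  have hform : ∀ x : ℝ × ℝ, f x = x.1 * f (1, 0) + x.2 * f (0, 1) := fun x => by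
    have : x = x.1 • ((1, 0) : ℝ × ℝ) + x.2 • ((0, 1) : ℝ × ℝ) := by ext <;> simp
    conv_lhs => rw [this, map_add, map_smul, map_smul]
    simp only [smul_eq_mul]
  have w1 := triDet_vtx_pos hqr hrs
  have w2 := triDet_vtx_pos (hpq.trans hqr) hrs
  have w3 := triDet_vtx_pos hpq (hqr.trans hrs)
  have w4 := triDet_vtx_pos hpq hqr
  have hsum : triDet (vtx n q) (vtx n r) (vtx n s) + triDet (vtx n p) (vtx n q) (vtx n s) =
      triDet (vtx n p) (vtx n r) (vtx n s) + triDet (vtx n p) (vtx n q) (vtx n r) := by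
    simp only [triDet]; ring
  have hrel : triDet (vtx n q) (vtx n r) (vtx n s) * f (vtx n p) +
      triDet (vtx n p) (vtx n q) (vtx n s) * f (vtx n r) =
      triDet (vtx n p) (vtx n r) (vtx n s) * f (vtx n q) +
      triDet (vtx n p) (vtx n q) (vtx n r) * f (vtx n s) := by
    rw [hform (vtx n p), hform (vtx n q), hform (vtx n r), hform (vtx n s)]
    simp only [triDet]; ring
  have hp1 := hle p hp
  have hr1 := hle r hr
  have hq1 := hge q hq
  have hs1 := hge s hs
  have hp2 := mul_nonneg w1.le (sub_nonneg.2 hp1)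
  have hr2 := mul_nonneg w3.le (sub_nonneg.2 hr1)
  have hq2 := mul_nonneg w2.le (sub_nonneg.2 hq1)
  have hs2 := mul_nonneg w4.le (sub_nonneg.2 hs1)
  have hzero := congrArg (· * u) hsum
  have ep : f (vtx n p) = u := by
    have := (mul_eq_zero.1 (le_antisymm (by linarith) hp2)).resolve_left w1.ne'
    linarith
  have er : f (vtx n r) = u := by
    have := (mul_eq_zero.1 (le_antisymm (by linarith) hr2)).resolve_left w3.ne'
    linarith
  have eq : f (vtx n q) = u := by
    have := (mul_eq_zero.1 (le_antisymm (by linarith) hq2)).resolve_left w2.ne'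
    linarith
  rw [hform] at ep er eq
  have hx : triDet (vtx n p) (vtx n q) (vtx n r) * f (1, 0) = 0 := by
    simp only [triDet]
    linear_combination ((vtx n r).2 - (vtx n p).2) * (eq - ep) -
      ((vtx n q).2 - (vtx n p).2) * (er - ep)
  have hy : triDet (vtx n p) (vtx n q) (vtx n r) * f (0, 1) = 0 := by
    simp only [triDet]
    linear_combination ((vtx n q).1 - (vtx n p).1) * (er - ep) -
      ((vtx n r).1 - (vtx n p).1) * (eq - ep)
  have hx := (mul_eq_zero.1 hx).resolve_left w4.ne'
  have hy := (mul_eq_zero.1 hy).resolve_left w4.ne'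
  obtain ⟨a, ha⟩ := hinterior
  obtain ⟨b, hb⟩ := hinterior'
  have h1 := hf a ha
  have h2 := hf' b hb
  rw [hform, hx, hy] at h1 h2
  linarith

section SmithForm

open Matrix

variable {ι κ : Type*} [Fintype ι] [DecidableEq ι] [Fintype κ] [DecidableEq κ]

/-- `M` is equivalent over `ℤ` to a diagonal matrix with `r` entries `x`, the others being `1`. -/
def HasSmithForm (x : ℤ) (r : ℕ) (M : Matrix ι ι ℤ) : Prop :=
  ∃ U V : Matrix ι ι ℤ, IsUnit U ∧ IsUnit V ∧ ∃ R : Finset ι, R.card = r ∧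
    U * M * V = diagonal fun i => if i ∈ R then x else 1

lemma isUnit_submatrix (e : ι ≃ κ) {U : Matrix κ κ ℤ} (h : IsUnit U) :
    IsUnit (U.submatrix e e) := by
  rw [isUnit_iff_isUnit_det] at h ⊢
  rwa [det_submatrix_equiv_self]

lemma isUnit_fromBlocks_diagonal {A : Matrix ι ι ℤ} {D : Matrix κ κ ℤ} (hA : IsUnit A)
    (hD : IsUnit D) : IsUnit (fromBlocks A 0 0 D) := by
  rw [isUnit_iff_isUnit_det] at hA hD ⊢
  rw [det_fromBlocks_zero₂₁]
  exact hA.mul hD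

lemma isUnit_fromBlocks_one_lower (X : Matrix κ ι ℤ) :
    IsUnit (fromBlocks (1 : Matrix ι ι ℤ) 0 X (1 : Matrix κ κ ℤ)) := by
  rw [isUnit_iff_isUnit_det, det_fromBlocks_zero₁₂]
  simp

lemma isUnit_fromBlocks_one_upper (X : Matrix ι κ ℤ) :
    IsUnit (fromBlocks (1 : Matrix ι ι ℤ) X 0 (1 : Matrix κ κ ℤ)) := by
  rw [isUnit_iff_isUnit_det, det_fromBlocks_zero₂₁]
  simp

lemma HasSmithForm.submatrix {x : ℤ} {r : ℕ} {M : Matrix κ κ ℤ} (h : HasSmithForm x r M)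
    (e : ι ≃ κ) : HasSmithForm x r (M.submatrix e e) := by
  obtain ⟨U, V, hU, hV, R, hR, hUV⟩ := h
  refine ⟨U.submatrix e e, V.submatrix e e, isUnit_submatrix e hU, isUnit_submatrix e hV,
    R.map e.symm.toEmbedding, by simpa using hR, ?_⟩
  rw [submatrix_mul_equiv, submatrix_mul_equiv, hUV, submatrix_diagonal_equiv]
  congr 1
  funext i
  simp

lemma HasSmithForm.of_submatrix {x : ℤ} {r : ℕ} {M : Matrix κ κ ℤ} (e : ι ≃ κ)
    (h : HasSmithForm x r (M.submatrix e e)) : HasSmithForm x r M := by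
  simpa using h.submatrix e.symm

lemma HasSmithForm.mul_mul {x : ℤ} {r : ℕ} {M P Q : Matrix ι ι ℤ} (h : HasSmithForm x r M)
    (hP : IsUnit P) (hQ : IsUnit Q) : HasSmithForm x r (P * M * Q) := by
  obtain ⟨U, V, hU, hV, R, hR, hUV⟩ := h
  obtain ⟨P, rfl⟩ := hP
  obtain ⟨Q, rfl⟩ := hQ
  refine ⟨U * (P⁻¹ : (Matrix ι ι ℤ)ˣ), (Q⁻¹ : (Matrix ι ι ℤ)ˣ) * V, hU.mul (Units.isUnit _),
    (Units.isUnit _).mul hV, R, hR, ?_⟩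
  rw [← hUV]
  simp only [Matrix.mul_assoc, Units.inv_mul_cancel_left, Units.mul_inv_cancel_left]

lemma HasSmithForm.neg {x : ℤ} {r : ℕ} {M : Matrix ι ι ℤ} (h : HasSmithForm x r M) :
    HasSmithForm x r (-M) := by
  simpa using h.mul_mul (isUnit_one.neg : IsUnit (-1 : Matrix ι ι ℤ)) isUnit_one

lemma HasSmithForm.fromBlocks {x : ℤ} {r s : ℕ} {M : Matrix ι ι ℤ} {N : Matrix κ κ ℤ}
    (hM : HasSmithForm x r M) (hN : HasSmithForm x s N) :
    HasSmithForm x (r + s) (fromBlocks M 0 0 N) := by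
  obtain ⟨U, V, hU, hV, R, hR, hUV⟩ := hM
  obtain ⟨U', V', hU', hV', R', hR', hUV'⟩ := hN
  refine ⟨_, _, isUnit_fromBlocks_diagonal hU hU', isUnit_fromBlocks_diagonal hV hV',
    R.disjSum R', by simp [hR, hR'], ?_⟩
  simp only [fromBlocks_multiply, Matrix.mul_zero, Matrix.zero_mul, add_zero, zero_add, hUV, hUV',
    fromBlocks_diagonal]
  congr 1
  funext i
  cases i <;> simp

lemma hasSmithForm_one_add_ones {e : ℕ} (he : 1 ≤ e) (hι : Fintype.card ι = e) :
    HasSmithForm (e + 1 : ℤ) 1 (1 + of fun _ _ => 1 : Matrix ι ι ℤ) := by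
  let φ : Unit ⊕ Fin (e - 1) ≃ ι := Fintype.equivOfCardEq (by simp; omega)
  refine HasSmithForm.of_submatrix φ ?_
  have hblock : (1 + of fun _ _ => 1 : Matrix ι ι ℤ).submatrix φ φ =
      (Matrix.fromBlocks 1 0 (of fun _ _ => 1) 1 *
        Matrix.fromBlocks 1 (of fun _ _ => 1) 0 1) *
      diagonal (Sum.elim (fun _ => (e + 1 : ℤ)) fun _ => 1) *
      Matrix.fromBlocks 1 0 (of fun _ _ => -1) 1 := by
    rw [← fromBlocks_diagonal]
    simp only [fromBlocks_multiply]
    ext i j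
    rcases i with i | i <;> rcases j with j | j
    · simp [Matrix.mul_apply, one_apply]
      push_cast [he]
      ring
    · simp [one_apply]
    · simp [Matrix.mul_apply, one_apply, Finset.sum_add_distrib]
      push_cast [he]
      ring
    · simp [Matrix.mul_apply, one_apply, add_comm]
  rw [hblock]
  refine HasSmithForm.mul_mul ?_ ((isUnit_fromBlocks_one_lower _).mul
    (isUnit_fromBlocks_one_upper _)) (isUnit_fromBlocks_one_lower _)
  refine ⟨1, 1, isUnit_one, isUnit_one, {Sum.inl ()}, by simp, ?_⟩
  rw [Matrix.one_mul, Matrix.mul_one]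
  congr 1
  funext i
  cases i <;> simp

/-- The exceptional diagonal entries can be moved to any prescribed set of positions. -/
lemma HasSmithForm.exists_diagonal {x : ℤ} {r : ℕ} {M : Matrix ι ι ℤ} (h : HasSmithForm x r M)
    (p : ι → Prop) [DecidablePred p] (hp : (Finset.univ.filter fun i => ¬ p i).card = r) :
    ∃ U V : Matrix ι ι ℤ, IsUnit U.det ∧ IsUnit V.det ∧
      U * M * V = diagonal fun i => if p i then 1 else x := by
  obtain ⟨U, V, hU, hV, R, hR, hUV⟩ := h
  have hcard : Fintype.card {i // ¬ p i} = Fintype.card {i // i ∈ R} := by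
    rw [Fintype.card_subtype, hp, Fintype.card_coe, hR]
  let σ : Equiv.Perm ι := (Fintype.equivOfCardEq hcard).extendSubtype
  have hσ : ∀ i, σ i ∈ R ↔ ¬ p i := fun i => by
    constructor
    · intro hi hpi
      exact Equiv.extendSubtype_not_mem _ i (not_not.2 hpi) hi
    · exact fun hi => Equiv.extendSubtype_mem _ i hi
  refine ⟨U.submatrix σ id, V.submatrix id σ, ?_, ?_, ?_⟩
  · rw [det_permute]
    exact ((Equiv.Perm.sign σ).isUnit.map (Int.castRingHom ℤ)).mul ((isUnit_iff_isUnit_det _).1 hU)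
  · rw [det_permute']
    exact ((Equiv.Perm.sign σ).isUnit.map (Int.castRingHom ℤ)).mul ((isUnit_iff_isUnit_det _).1 hV)
  · have : U.submatrix σ id * M * V.submatrix id σ = (U * M * V).submatrix σ σ := by
      ext i j
      simp [Matrix.mul_apply]
    rw [this, hUV, submatrix_diagonal_equiv]
    congr 1
    funext i
    simp [hσ, ite_not]

end SmithForm

section Assignments

variable {V : Type*} [Fintype V] [LinearOrder V]

open Classical in
/-- Assignments of an incident cell of `T` to each vertex of `A`, using each cell at most `e` times;
vertices outside `A` carry the value `∅`. -/
noncomputable def cellAssignments (e : ℕ) (T : Finset (Finset V)) (A : Finset V) :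
    Finset (V → Finset V) :=
  {f | (∀ v ∈ A, f v ∈ T ∧ v ∈ f v) ∧ (∀ v ∉ A, f v = ∅) ∧
    ∀ c ∈ T, (A.filter (fun v => f v = c)).card ≤ e}

lemma mem_cellAssignments {e : ℕ} {T : Finset (Finset V)} {A : Finset V}
    {f : V → Finset V} :
    f ∈ cellAssignments e T A ↔ (∀ v ∈ A, f v ∈ T ∧ v ∈ f v) ∧ (∀ v ∉ A, f v = ∅) ∧
      ∀ c ∈ T, (A.filter (fun v => f v = c)).card ≤ e := by
  simp only [cellAssignments, Finset.mem_filter, Finset.mem_univ, true_and]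

lemma card_cellAssignments_empty (e : ℕ) (T : Finset (Finset V)) :
    (cellAssignments e T ∅).card = 1 := by
  rw [Finset.card_eq_one]
  refine ⟨fun _ => ∅, ?_⟩
  ext f
  simp [mem_cellAssignments, funext_iff]

lemma card_cellAssignments_eq_zero {e : ℕ} {T : Finset (Finset V)} {A : Finset V}
    (h : T.card * e < A.card) : (cellAssignments e T A).card = 0 := by
  rw [Finset.card_eq_zero, Finset.eq_empty_iff_forall_notMem]
  intro f hf
  obtain ⟨h1, -, h3⟩ := mem_cellAssignments.1 hf
  have := Finset.card_le_mul_card_image_of_maps_to (f := f) (s := A) (t := T)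
    (fun v hv => (h1 v hv).1) e h3
  rw [mul_comm] at this
  omega

lemma card_cellAssignments_insert {e : ℕ} {T : Finset (Finset V)} {A c E : Finset V}
    (hc : c ∉ T) (hne : c ≠ ∅) (hEc : E ⊆ c) (hE : ∀ c' ∈ T, Disjoint c' E) :
    (cellAssignments e (insert c T) A).card =
      ∑ B ∈ (A ∩ (c \ E)).powerset with (A ∩ E).card + B.card ≤ e,
        (cellAssignments e T ((A \ E) \ B)).card := by
  rw [Finset.card_eq_sum_card_fiberwise (f := fun f => (A.filter (fun v => f v = c)) \ E)
    (t := (A ∩ (c \ E)).powerset.filter (fun B => (A ∩ E).card + B.card ≤ e))]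
  · refine Finset.sum_congr rfl fun B hB => ?_
    simp only [Finset.mem_filter, Finset.mem_powerset] at hB
    obtain ⟨hB, hBe⟩ := hB
    refine Finset.card_bij' (fun f _ v => if f v = c then ∅ else f v)
      (fun g _ v => if v ∈ (A ∩ E) ∪ B then c else g v) ?_ ?_ ?_ ?_
    · intro f hf
      simp only [Finset.mem_filter, mem_cellAssignments] at hf
      obtain ⟨⟨h1, h2, h3⟩, h4⟩ := hf
      rw [mem_cellAssignments]
      have key : ∀ v ∈ (A \ E) \ B, f v ≠ c := by
        intro v hv h
        simp only [Finset.mem_sdiff] at hv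
        apply hv.2
        rw [← h4]
        simp [hv.1, h]
      refine ⟨fun v hv => ?_, fun v hv => ?_, fun c' hc' => ?_⟩
      · rw [if_neg (key v hv)]
        simp only [Finset.mem_sdiff] at hv
        have := h1 v hv.1.1
        refine ⟨Finset.mem_of_mem_insert_of_ne this.1 (key v (by simp [hv])), this.2⟩
      · by_cases hA : v ∈ A
        · by_cases hvE : v ∈ E
          · have := h1 v hA
            rw [if_pos]
            by_contra hne'
            exact Finset.disjoint_left.1 (hE _ (Finset.mem_of_mem_insert_of_ne this.1 hne'))
              this.2 hvE
          · have hvB : v ∈ B := by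
              by_contra hvB
              exact hv (by simp [hA, hvE, hvB])
            rw [← h4] at hvB
            simp only [Finset.mem_sdiff, Finset.mem_filter] at hvB
            rw [if_pos hvB.1.2]
        · rw [h2 v hA]; simp
      · refine le_trans (Finset.card_le_card ?_) (h3 c' (Finset.mem_insert_of_mem hc'))
        intro v hv
        simp only [Finset.mem_filter] at hv ⊢
        rw [if_neg (key v hv.1)] at hv
        exact ⟨(Finset.mem_sdiff.1 (Finset.mem_sdiff.1 hv.1).1).1, hv.2⟩
    · intro g hg
      obtain ⟨h1, h2, h3⟩ := mem_cellAssignments.1 hg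
      have gne : ∀ v, g v ≠ c := by
        intro v h
        by_cases hv : v ∈ (A \ E) \ B
        · exact hc (h ▸ (h1 v hv).1)
        · exact hne (h ▸ h2 v hv)
      have hfc : A.filter (fun v => (if v ∈ (A ∩ E) ∪ B then c else g v) = c) = (A ∩ E) ∪ B := by
        ext v
        simp only [Finset.mem_filter, ite_eq_left_iff, gne, imp_false, not_not]
        have := @hB v
        simp only [Finset.mem_union, Finset.mem_inter] at this ⊢
        tauto
      simp only [Finset.mem_filter, mem_cellAssignments]
      refine ⟨⟨fun v hv => ?_, fun v hv => ?_, fun c' hc' => ?_⟩, ?_⟩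
      · split_ifs with h
        · refine ⟨Finset.mem_insert_self _ _, ?_⟩
          have h5 := @hB v
          have h6 := @hEc v
          simp only [Finset.mem_union, Finset.mem_inter, Finset.mem_sdiff] at h h5
          tauto
        · have := h1 v (by
            simp only [Finset.mem_union, Finset.mem_inter, Finset.mem_sdiff] at h ⊢; tauto)
          exact ⟨Finset.mem_insert_of_mem this.1, this.2⟩
      · have h5 := @hB v
        rw [if_neg, h2]
        · simp only [Finset.mem_sdiff]; tauto
        · simp only [Finset.mem_union, Finset.mem_inter, Finset.mem_sdiff] at h5 ⊢; tauto
      · by_cases hcc : c' = c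
        · subst hcc
          rw [hfc]
          exact (Finset.card_union_le _ _).trans hBe
        · refine le_trans (Finset.card_le_card ?_) (h3 c' (Finset.mem_of_mem_insert_of_ne hc' hcc))
          intro v hv
          simp only [Finset.mem_filter] at hv ⊢
          have hn : v ∉ (A ∩ E) ∪ B := fun h => by
            rw [if_pos h] at hv; exact hcc hv.2.symm
          rw [if_neg hn] at hv
          refine ⟨?_, hv.2⟩
          simp only [Finset.mem_union, Finset.mem_inter, Finset.mem_sdiff] at hn ⊢; tauto
      · rw [hfc]
        ext v
        have h5 := @hB v
        simp only [Finset.mem_union, Finset.mem_inter, Finset.mem_sdiff] at h5 ⊢; tauto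
    · intro f hf
      simp only [Finset.mem_filter, mem_cellAssignments] at hf
      obtain ⟨⟨h1, h2, h3⟩, h4⟩ := hf
      funext v
      have hiff : v ∈ (A ∩ E) ∪ B ↔ f v = c := by
        rw [← h4]
        simp only [Finset.mem_union, Finset.mem_inter, Finset.mem_sdiff, Finset.mem_filter]
        constructor
        · rintro (h | h)
          · by_contra hne'
            have := h1 v h.1
            exact Finset.disjoint_left.1 (hE _ (Finset.mem_of_mem_insert_of_ne this.1 hne'))
              this.2 h.2
          · exact h.1.2
        · intro h
          have : v ∈ A := by
            by_contra hA
            exact hne (h ▸ h2 v hA)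
          tauto
      by_cases h : f v = c
      · simp only [hiff, h, if_true]
      · simp only [hiff, h, if_false]
    · intro g hg
      obtain ⟨h1, h2, h3⟩ := mem_cellAssignments.1 hg
      funext v
      by_cases h : v ∈ (A ∩ E) ∪ B
      · simp only [h, if_true]
        rw [h2]
        simp only [Finset.mem_union, Finset.mem_inter, Finset.mem_sdiff] at h ⊢; tauto
      · have gne : g v ≠ c := by
          intro h
          by_cases hv : v ∈ (A \ E) \ B
          · exact hc (h ▸ (h1 v hv).1)
          · exact hne (h ▸ h2 v hv)
        simp only [h, if_false, gne]
  · intro f hf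
    obtain ⟨h1, h2, h3⟩ := mem_cellAssignments.1 (Finset.mem_coe.1 hf)
    simp only [Finset.coe_filter, Finset.mem_powerset, Set.mem_ofPred_eq]
    have hsub : A ∩ E ⊆ A.filter (fun v => f v = c) := by
      intro v hv
      simp only [Finset.mem_inter, Finset.mem_filter] at hv ⊢
      refine ⟨hv.1, ?_⟩
      by_contra hne'
      have := h1 v hv.1
      exact Finset.disjoint_left.1 (hE _ (Finset.mem_of_mem_insert_of_ne this.1 hne'))
        this.2 hv.2
    constructor
    · intro v hv
      simp only [Finset.mem_inter, Finset.mem_filter, Finset.mem_sdiff] at hv ⊢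
      have := (h1 v hv.1.1).2
      rw [hv.1.2] at this
      tauto
    · rw [← Finset.card_union_of_disjoint]
      · refine le_trans (Finset.card_le_card ?_) (h3 c (Finset.mem_insert_self _ _))
        exact Finset.union_subset hsub Finset.sdiff_subset
      · exact Finset.disjoint_left.2 fun v hv hv' =>
          (Finset.mem_sdiff.1 hv').2 (Finset.mem_inter.1 hv).2

end Assignments

section Arcs

variable {V : Type*} [Fintype V] [LinearOrder V]

/-- The elements of `S` strictly between `i` and `j` in the cyclic order. -/
def arc (S : Finset V) (i j : V) : Finset V :=
  S.filter fun v => if i < j then i < v ∧ v < j else i < v ∨ v < j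

/-- The number of paths from `i` to `j` in the polygon with vertex set `S`. -/
noncomputable def pathNum (e : ℕ) (T : Finset (Finset V)) (S : Finset V) (i j : V) : ℕ :=
  (cellAssignments e T (arc S i j)).card

lemma mem_arc {S : Finset V} {i j v : V} :
    v ∈ arc S i j ↔ v ∈ S ∧ ((i < j ∧ i < v ∧ v < j) ∨ (j ≤ i ∧ (i < v ∨ v < j))) := by
  simp only [arc, Finset.mem_filter]
  split_ifs with h
  · simp [h, not_le.2 h]
  · simp [h, not_lt.1 h]

lemma arc_self (S : Finset V) (i : V) : arc S i i = S.erase i := by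
  ext v
  simp [mem_arc, and_comm, eq_comm]

/-- The polygon `S' ∪ E` arises from the polygon `S'`, dissected by `T`, by gluing the cell
`E ∪ {a, b}` along the side `a b`. -/
structure IsEar (e : ℕ) (T : Finset (Finset V)) (S' E : Finset V) (a b : V) : Prop where
  lt : a < b
  left_mem : a ∈ S'
  right_mem : b ∈ S'
  between : ∀ x ∈ E, a < x ∧ x < b
  outside : ∀ x ∈ S', x ≤ a ∨ b ≤ x
  card_ear : E.card = e
  pos : 1 ≤ e
  disjoint : ∀ c ∈ T, Disjoint c E
  card_cells : S'.card = T.card * e + 2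

namespace IsEar

variable {e : ℕ} {T : Finset (Finset V)} {S' E : Finset V} {a b : V}

lemma card_insert (h : IsEar e T S' E a b) (A : Finset V) :
    (cellAssignments e (insert (insert a (insert b E)) T) A).card =
      ∑ B ∈ (A ∩ {a, b}).powerset with (A ∩ E).card + B.card ≤ e,
        (cellAssignments e T ((A \ E) \ B)).card := by
  have hsd : insert a (insert b E) \ E = {a, b} := by
    ext x
    have := h.between x
    have := h.lt
    simp only [Finset.mem_sdiff, Finset.mem_insert, Finset.mem_singleton]
    grind
  rw [card_cellAssignments_insert (E := E) _ (Finset.insert_ne_empty _ _)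
    ((Finset.subset_insert _ _).trans (Finset.subset_insert _ _)) h.disjoint, hsd]
  intro hc
  obtain ⟨x, hx⟩ := Finset.card_pos.1 (h.pos.trans_eq h.card_ear.symm)
  exact Finset.disjoint_left.1 (h.disjoint _ hc) (by simp [hx]) hx

lemma card_eq_zero (h : IsEar e T S' E a b) {A : Finset V} (hA : S'.card ≤ A.card + 1) :
    (cellAssignments e T A).card = 0 :=
  card_cellAssignments_eq_zero (by have := h.card_cells; omega)

lemma pathNum_self (h : IsEar e T S' E a b) {i : V} (hi : i ∈ S') : pathNum e T S' i i = 0 := by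
  rw [pathNum, arc_self]
  exact h.card_eq_zero (by rw [Finset.card_erase_of_mem hi]; omega)

lemma pathNum_left_right (h : IsEar e T S' E a b) : pathNum e T S' a b = 1 := by
  have : arc S' a b = ∅ := by
    ext v
    have := h.outside v
    have := h.lt
    simp only [mem_arc, Finset.notMem_empty, iff_false]
    grind
  rw [pathNum, this, card_cellAssignments_empty]

lemma inter_card_lt (h : IsEar e T S' E a b) {A : Finset V} {k : V} (hk : k ∈ E) (hkA : k ∉ A) :
    (A ∩ E).card < e := by
  rw [← h.card_ear]
  refine Finset.card_lt_card ⟨Finset.inter_subset_right, fun hs => hkA ?_⟩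
  exact (Finset.mem_inter.1 (hs hk)).1

lemma pathNum_old (h : IsEar e T S' E a b) {i j : V} (hi : i ∈ S') (hj : j ∈ S') :
    pathNum e (insert (insert a (insert b E)) T) (S' ∪ E) i j = pathNum e T S' i j := by
  have hab := h.lt
  have hio := h.outside i hi
  have hjo := h.outside j hj
  have harc : arc (S' ∪ E) i j \ E = arc S' i j := by
    ext v
    have h1 := h.between v
    have h2 := h.outside v
    simp only [Finset.mem_sdiff, mem_arc, Finset.mem_union]
    grind
  rw [pathNum, h.card_insert, Finset.sum_eq_single ∅]
  · rw [Finset.sdiff_empty, harc, pathNum]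
  · intro B hB hne
    exfalso
    simp only [Finset.mem_filter, Finset.mem_powerset] at hB
    obtain ⟨x, hx⟩ := Finset.nonempty_iff_ne_empty.2 hne
    have hBpos := Finset.card_pos.2 ⟨x, hx⟩
    have hxA := hB.1 hx
    simp only [Finset.mem_inter, Finset.mem_insert, Finset.mem_singleton, mem_arc] at hxA
    have hE : arc (S' ∪ E) i j ∩ E = E := by
      ext v
      have h1 := h.between v
      simp only [Finset.mem_inter, mem_arc, Finset.mem_union]
      grind
    have := hB.2
    rw [hE, h.card_ear] at this
    omega
  · intro hn
    exfalso
    apply hn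
    simp only [Finset.mem_filter, Finset.mem_powerset, Finset.empty_subset, true_and,
      Finset.card_empty, add_zero]
    exact (Finset.card_le_card Finset.inter_subset_right).trans h.card_ear.le

lemma card_insert_of_inter_empty (h : IsEar e T S' E a b) {A : Finset V}
    (hA : A ∩ {a, b} = ∅) : (cellAssignments e (insert (insert a (insert b E)) T) A).card =
      (cellAssignments e T (A \ E)).card := by
  have : (A ∩ E).card ≤ e :=
    (Finset.card_le_card Finset.inter_subset_right).trans h.card_ear.le
  rw [h.card_insert, hA, Finset.powerset_empty, Finset.filter_singleton]
  simp [this]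

lemma card_insert_of_inter_singleton (h : IsEar e T S' E a b) {A : Finset V} {x k : V}
    (hA : A ∩ {a, b} = {x}) (hk : k ∈ E) (hkA : k ∉ A) :
    (cellAssignments e (insert (insert a (insert b E)) T) A).card =
      (cellAssignments e T (A \ E)).card + (cellAssignments e T ((A \ E).erase x)).card := by
  have := h.inter_card_lt hk hkA
  rw [h.card_insert, hA, Finset.filter_true_of_mem]
  · rw [← insert_empty_eq x, Finset.sum_powerset_insert (Finset.notMem_empty x)]
    simp [Finset.sdiff_singleton_eq_erase]
  · intro B hB
    have := Finset.card_le_card (Finset.mem_powerset.1 hB)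
    rw [Finset.card_singleton] at this
    omega

lemma pathNum_new_old (h : IsEar e T S' E a b) {k j : V} (hk : k ∈ E) (hj : j ∈ S') :
    pathNum e (insert (insert a (insert b E)) T) (S' ∪ E) k j =
      pathNum e T S' a j + pathNum e T S' b j := by
  have hab := h.lt
  have hak := h.between k hk
  have hjo := h.outside j hj
  have haS := h.left_mem
  have hbS := h.right_mem
  by_cases hjb : j = b
  · subst hjb
    rw [h.pathNum_self hj, h.pathNum_left_right, pathNum, h.card_insert_of_inter_empty]
    · have : arc (S' ∪ E) k j \ E = ∅ := by
        ext v
        have h2 := h.outside v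
        simp only [Finset.mem_sdiff, mem_arc, Finset.mem_union, Finset.notMem_empty, iff_false]
        grind
      rw [this, card_cellAssignments_empty]
    · ext v
      simp only [Finset.mem_inter, mem_arc, Finset.mem_union, Finset.notMem_empty, iff_false,
        Finset.mem_insert, Finset.mem_singleton]
      grind
  · rw [pathNum, h.card_insert_of_inter_singleton (x := b) _ hk]
    · congr 2
      · congr 1
        ext v
        have h1 := h.between v
        have h2 := h.outside v
        simp only [Finset.mem_sdiff, mem_arc, Finset.mem_union]
        grind
      · congr 1
        ext v
        have h1 := h.between v
        have h2 := h.outside v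
        simp only [Finset.mem_sdiff, mem_arc, Finset.mem_union, Finset.mem_erase]
        grind
    · simp only [mem_arc]
      grind
    · ext v
      simp only [Finset.mem_inter, mem_arc, Finset.mem_union, Finset.mem_insert,
        Finset.mem_singleton]
      grind

lemma pathNum_old_new (h : IsEar e T S' E a b) {k j : V} (hk : k ∈ E) (hj : j ∈ S') :
    pathNum e (insert (insert a (insert b E)) T) (S' ∪ E) j k =
      pathNum e T S' j a + pathNum e T S' j b := by
  have hab := h.lt
  have hak := h.between k hk
  have hjo := h.outside j hj
  have haS := h.left_mem
  have hbS := h.right_mem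
  by_cases hja : j = a
  · subst hja
    rw [h.pathNum_self hj, h.pathNum_left_right, pathNum, h.card_insert_of_inter_empty]
    · have : arc (S' ∪ E) j k \ E = ∅ := by
        ext v
        have h2 := h.outside v
        simp only [Finset.mem_sdiff, mem_arc, Finset.mem_union, Finset.notMem_empty, iff_false]
        grind
      rw [this, card_cellAssignments_empty]
    · ext v
      simp only [Finset.mem_inter, mem_arc, Finset.mem_union, Finset.notMem_empty, iff_false,
        Finset.mem_insert, Finset.mem_singleton]
      grind
  · rw [pathNum, h.card_insert_of_inter_singleton (x := a) _ hk, add_comm]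
    · congr 2
      · congr 1
        ext v
        have h1 := h.between v
        have h2 := h.outside v
        simp only [Finset.mem_sdiff, mem_arc, Finset.mem_union, Finset.mem_erase]
        grind
      · congr 1
        ext v
        have h1 := h.between v
        have h2 := h.outside v
        simp only [Finset.mem_sdiff, mem_arc, Finset.mem_union]
        grind
    · simp only [mem_arc]
      grind
    · ext v
      simp only [Finset.mem_inter, mem_arc, Finset.mem_union, Finset.mem_insert,
        Finset.mem_singleton]
      grind

lemma pathNum_new_of_lt (h : IsEar e T S' E a b) {k l : V} (hk : k ∈ E) (hl : l ∈ E)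
    (hkl : k < l) : pathNum e (insert (insert a (insert b E)) T) (S' ∪ E) k l = 1 := by
  have hak := h.between k hk
  have hal := h.between l hl
  rw [pathNum, h.card_insert_of_inter_empty]
  · have : arc (S' ∪ E) k l \ E = ∅ := by
      ext v
      have h2 := h.outside v
      simp only [Finset.mem_sdiff, mem_arc, Finset.mem_union, Finset.notMem_empty, iff_false]
      grind
    rw [this, card_cellAssignments_empty]
  · ext v
    simp only [Finset.mem_inter, mem_arc, Finset.mem_union, Finset.notMem_empty, iff_false,
      Finset.mem_insert, Finset.mem_singleton]
    grind

lemma pathNum_new_of_ge (h : IsEar e T S' E a b) {k l : V} (hk : k ∈ E) (hl : l ∈ E)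
    (hlk : l ≤ k) : pathNum e (insert (insert a (insert b E)) T) (S' ∪ E) k l =
      if k = l then 0 else pathNum e T S' b a := by
  have hab := h.lt
  have hak := h.between k hk
  have hal := h.between l hl
  have haS := h.left_mem
  have hbS := h.right_mem
  have hA : arc (S' ∪ E) k l \ E = S' := by
    ext v
    have h1 := h.between v
    have h2 := h.outside v
    simp only [Finset.mem_sdiff, mem_arc, Finset.mem_union]
    grind
  have hAab : arc (S' ∪ E) k l ∩ {a, b} = {a, b} := by
    ext v
    simp only [Finset.mem_inter, mem_arc, Finset.mem_union, Finset.mem_insert,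
      Finset.mem_singleton]
    grind
  have hcard : ({a, b} : Finset V).card = 2 := Finset.card_pair hab.ne
  rw [pathNum, h.card_insert, hA, hAab, Finset.sum_filter, Finset.sum_eq_single {a, b}]
  · rw [hcard]
    by_cases hkl : k = l
    · subst hkl
      have hsub : E.erase k ⊆ arc (S' ∪ E) k k ∩ E := by
        rw [arc_self]
        intro v hv
        simp only [Finset.mem_erase, Finset.mem_inter, Finset.mem_union] at hv ⊢
        tauto
      have := Finset.card_le_card hsub
      rw [Finset.card_erase_of_mem hk, h.card_ear] at this
      rw [if_neg (by omega), if_pos rfl]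
    · have hsub : arc (S' ∪ E) k l ∩ E ⊆ (E.erase k).erase l := by
        intro v
        simp only [Finset.mem_erase, Finset.mem_inter, mem_arc, Finset.mem_union]
        grind
      have := Finset.card_le_card hsub
      have h2 : 0 < (E.erase k).card := Finset.card_pos.2 ⟨l, by grind⟩
      rw [Finset.card_erase_of_mem (by grind)] at this
      rw [Finset.card_erase_of_mem hk, h.card_ear] at this h2
      rw [if_pos (by omega), if_neg hkl, pathNum]
      congr 2
      ext v
      have h2 := h.outside v
      simp only [Finset.mem_sdiff, mem_arc, Finset.mem_insert, Finset.mem_singleton]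
      grind
  · intro B hB hne
    have hss : B ⊂ {a, b} := (Finset.mem_powerset.1 hB).ssubset_of_ne hne
    have h1 := Finset.card_lt_card hss
    rw [h.card_eq_zero, ite_self]
    have := Finset.le_card_sdiff B S'
    omega
  · intro hn
    exact absurd (Finset.mem_powerset_self _) hn

lemma pathNum_new (h : IsEar e T S' E a b) (hsymm : pathNum e T S' a b = pathNum e T S' b a)
    {k l : V} (hk : k ∈ E) (hl : l ∈ E) :
    pathNum e (insert (insert a (insert b E)) T) (S' ∪ E) k l = if k = l then 0 else 1 := by
  rcases lt_or_ge k l with hkl | hkl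
  · rw [h.pathNum_new_of_lt hk hl hkl, if_neg hkl.ne]
  · rw [h.pathNum_new_of_ge hk hl hkl, ← hsymm, h.pathNum_left_right]

lemma pathNum_comm (h : IsEar e T S' E a b)
    (hsymm : ∀ i ∈ S', ∀ j ∈ S', pathNum e T S' i j = pathNum e T S' j i) {i j : V}
    (hi : i ∈ S' ∪ E) (hj : j ∈ S' ∪ E) :
    pathNum e (insert (insert a (insert b E)) T) (S' ∪ E) i j =
      pathNum e (insert (insert a (insert b E)) T) (S' ∪ E) j i := by
  have hab := hsymm a h.left_mem b h.right_mem
  rcases Finset.mem_union.1 hi with hi | hi <;> rcases Finset.mem_union.1 hj with hj | hj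
  · rw [h.pathNum_old hi hj, h.pathNum_old hj hi, hsymm i hi j hj]
  · rw [h.pathNum_old_new hj hi, h.pathNum_new_old hj hi, hsymm i hi a h.left_mem,
      hsymm i hi b h.right_mem]
  · rw [h.pathNum_old_new hi hj, h.pathNum_new_old hi hj, hsymm j hj a h.left_mem,
      hsymm j hj b h.right_mem]
  · simp only [h.pathNum_new hab hi hj, h.pathNum_new hab hj hi, eq_comm]

lemma hasSmithForm (h : IsEar e T S' E a b)
    (hsymm : pathNum e T S' a b = pathNum e T S' b a)
    (hS : HasSmithForm (e + 1 : ℤ) T.card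
      (Matrix.of fun i j : S' => (pathNum e T S' i j : ℤ))) :
    HasSmithForm (e + 1 : ℤ) (T.card + 1) (Matrix.of fun i j : (S' ∪ E : Finset V) =>
      (pathNum e (insert (insert a (insert b E)) T) (S' ∪ E) i j : ℤ)) := by
  have hdisj : Disjoint S' E := Finset.disjoint_left.2 fun x hx hx' => by
    have := h.between x hx'
    have := h.outside x hx
    grind
  refine HasSmithForm.of_submatrix (Equiv.Finset.union S' E hdisj) ?_
  let X : Matrix E S' ℤ := Matrix.of fun _ i =>
    (if i = ⟨a, h.left_mem⟩ then 1 else 0) + if i = ⟨b, h.right_mem⟩ then 1 else 0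
  have hN := (hasSmithForm_one_add_ones (ι := E) h.pos (by simp [h.card_ear])).neg
  have := (hS.fromBlocks hN).mul_mul (isUnit_fromBlocks_one_lower X)
    (isUnit_fromBlocks_one_upper X.transpose)
  convert this using 1
  rw [Matrix.fromBlocks_multiply, Matrix.fromBlocks_multiply]
  have hXM : ∀ (k : E) (j : S'), (X * Matrix.of fun i j : S' => (pathNum e T S' i j : ℤ)) k j =
      pathNum e T S' a j + pathNum e T S' b j := by
    intro k j
    simp [X, Matrix.mul_apply, add_mul, Finset.sum_add_distrib]
  ext i j
  rcases i with i | i <;> rcases j with j | j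
  · simp [h.pathNum_old i.2 j.2]
  · simp only [Matrix.submatrix_apply, Matrix.of_apply, Equiv.Finset.union_inl,
      Equiv.Finset.union_inr, h.pathNum_old_new j.2 i.2]
    simp [X, Matrix.mul_apply, mul_add, Finset.sum_add_distrib]
  · simp only [Matrix.submatrix_apply, Matrix.of_apply, Equiv.Finset.union_inl,
      Equiv.Finset.union_inr, h.pathNum_new_old i.2 j.2]
    simp [hXM]
  · simp only [Matrix.submatrix_apply, Matrix.of_apply,
      Equiv.Finset.union_inr, h.pathNum_new hsymm i.2 j.2]
    have : (X * (Matrix.of fun i j : S' => (pathNum e T S' i j : ℤ)) * X.transpose) i j = 2 := by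
      rw [Matrix.mul_apply]
      simp [hXM, X, mul_add, Finset.sum_add_distrib, h.pathNum_self h.left_mem,
        h.pathNum_self h.right_mem, ← hsymm, h.pathNum_left_right]
    simp [this, Matrix.one_apply]
    split_ifs <;> norm_num

end IsEar

lemma pathNum_empty_cells {e : ℕ} {S : Finset V} (hS : S.card = 2) {i j : V} (hi : i ∈ S)
    (hj : j ∈ S) : pathNum e ∅ S i j = if i = j then 0 else 1 := by
  split_ifs with h
  · subst h
    rw [pathNum, arc_self]
    exact card_cellAssignments_eq_zero (by rw [Finset.card_erase_of_mem hi, hS]; simp)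
  · have hSij : {i, j} = S :=
      Finset.eq_of_subset_of_card_le (by grind) (by rw [hS, Finset.card_pair h])
    have : arc S i j = ∅ := by
      ext v
      simp only [mem_arc, ← hSij, Finset.mem_insert, Finset.mem_singleton, Finset.notMem_empty,
        iff_false]
      grind
    rw [pathNum, this, card_cellAssignments_empty]

lemma hasSmithForm_empty_cells {e : ℕ} {S : Finset V} (hS : S.card = 2) (x : ℤ) :
    HasSmithForm x 0 (Matrix.of fun i j : S => (pathNum e ∅ S i j : ℤ)) := by
  let φ : Fin 2 ≃ S := Fintype.equivOfCardEq (by simp [hS])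
  refine HasSmithForm.of_submatrix φ ?_
  have : (Matrix.of fun i j : S => (pathNum e ∅ S i j : ℤ)).submatrix φ φ = !![0, 1; 1, 0] := by
    ext i j
    simp only [Matrix.submatrix_apply, Matrix.of_apply,
      pathNum_empty_cells hS (φ i).2 (φ j).2, Subtype.coe_inj, φ.injective.eq_iff]
    fin_cases i <;> fin_cases j <;> simp
  rw [this]
  refine ⟨!![0, 1; 1, 0], 1, ?_, isUnit_one, ∅, rfl, ?_⟩
  · rw [Matrix.isUnit_iff_isUnit_det]; simp [Matrix.det_fin_two]
  · ext i j
    fin_cases i <;> fin_cases j <;> simp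

/-- No two chords of distinct cells cross. -/
def Noncrossing (T : Finset (Finset V)) : Prop :=
  ∀ c ∈ T, ∀ c' ∈ T, c ≠ c' → ∀ p ∈ c, ∀ q ∈ c', ∀ r ∈ c, ∀ s ∈ c', p < q → q < r → ¬ r < s

/-- A cell whose span is minimal is an ear: no other cell reaches strictly between its extreme
vertices. -/
lemma Noncrossing.exists_extremal_cell {e : ℕ} {T : Finset (Finset V)} {S : Finset V}
    (hT : Noncrossing T) (hcard : ∀ c ∈ T, c ⊆ S ∧ c.card = e + 2) (hne : T.Nonempty) :
    ∃ c ∈ T, ∃ a ∈ c, ∃ b ∈ c, (∀ x ∈ c, a ≤ x ∧ x ≤ b) ∧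
      ∀ c' ∈ T, c' ≠ c → ∀ x ∈ c', x ≤ a ∨ b ≤ x := by
  let span : Finset V → Finset V := fun c =>
    S.filter fun x => (∃ u ∈ c, u ≤ x) ∧ ∃ w ∈ c, x ≤ w
  obtain ⟨c, hc, hmin⟩ := T.exists_min_image (fun c => (span c).card) hne
  have hcne : c.Nonempty := Finset.card_pos.1 (by rw [(hcard c hc).2]; omega)
  have ha := c.min'_mem hcne
  have hb := c.max'_mem hcne
  have hlo : ∀ x ∈ c, c.min' hcne ≤ x := fun x hx => c.min'_le x hx
  have hhi : ∀ x ∈ c, x ≤ c.max' hcne := fun x hx => c.le_max' x hx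
  refine ⟨c, hc, _, ha, _, hb, fun x hx => ⟨hlo x hx, hhi x hx⟩, fun c' hc' hne' x hx => ?_⟩
  generalize c.min' hcne = a at *
  generalize c.max' hcne = b at *
  by_contra! hx'
  have hlo' : ∀ y ∈ c', a ≤ y := fun y hy => by
    by_contra! h
    exact hT c' hc' c hc hne' y hy a ha x hx b hb h hx'.1 hx'.2
  have hhi' : ∀ y ∈ c', y ≤ b := fun y hy => by
    by_contra! h
    exact hT c hc c' hc' hne'.symm a ha x hx b hb y hy hx'.1 hx'.2 h
  have hsub : span c' ⊆ span c := by
    intro y hy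
    simp only [span, Finset.mem_filter] at hy ⊢
    obtain ⟨hyS, ⟨u, hu, hu'⟩, w, hw, hw'⟩ := hy
    exact ⟨hyS, ⟨a, ha, (hlo' u hu).trans hu'⟩, b, hb, hw'.trans (hhi' w hw)⟩
  have heq : span c' = span c := Finset.eq_of_subset_of_card_le hsub (hmin c' hc')
  have hmem : ∀ y ∈ c, y ∈ span c' := fun y hy => by
    rw [heq]
    simp only [span, Finset.mem_filter]
    exact ⟨(hcard c hc).1 hy, ⟨y, hy, le_rfl⟩, y, hy, le_rfl⟩
  have ha' : a ∈ c' := by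
    have := hmem a ha
    simp only [span, Finset.mem_filter] at this
    obtain ⟨-, ⟨u, hu, hu'⟩, -⟩ := this
    rwa [(hlo' u hu).antisymm hu']
  have hb' : b ∈ c' := by
    have := hmem b hb
    simp only [span, Finset.mem_filter] at this
    obtain ⟨-, -, w, hw, hw'⟩ := this
    rwa [hw'.antisymm (hhi' w hw)]
  obtain ⟨y, hy, hyn⟩ : ∃ y ∈ c, y ∉ c' := by
    by_contra! h
    exact hne' (Finset.eq_of_subset_of_card_le h
      (by rw [(hcard c hc).2, (hcard c' hc').2])).symm
  obtain ⟨z, hz, hzn⟩ : ∃ z ∈ c', z ∉ c := by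
    by_contra! h
    exact hne' (Finset.eq_of_subset_of_card_le h
      (by rw [(hcard c hc).2, (hcard c' hc').2]))
  have h1 := hlo y hy
  have h2 := hhi y hy
  have h3 := hlo' z hz
  have h4 := hhi' z hz
  rcases lt_trichotomy y z with hyz | hyz | hyz
  · exact hT c' hc' c hc hne' a ha' y hy z hz b hb (by grind) hyz (by grind)
  · exact hyn (hyz ▸ hz)
  · exact hT c hc c' hc' hne'.symm a ha z hz y hy b hb' (by grind) hyz (by grind)

theorem Noncrossing.hasSmithForm {e : ℕ} (he : 1 ≤ e) {T : Finset (Finset V)} {S : Finset V}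
    (hT : Noncrossing T) (hcard : ∀ c ∈ T, c ⊆ S ∧ c.card = e + 2) (hS : 2 ≤ S.card)
    (hle : S.card ≤ T.card * e + 2) :
    S.card = T.card * e + 2 ∧ (∀ i ∈ S, ∀ j ∈ S, pathNum e T S i j = pathNum e T S j i) ∧
      HasSmithForm (e + 1 : ℤ) T.card (Matrix.of fun i j : S => (pathNum e T S i j : ℤ)) := by
  induction hN : T.card generalizing T S with
  | zero =>
    obtain rfl := Finset.card_eq_zero.1 hN
    have hS2 : S.card = 2 := by simp at hle; omega
    refine ⟨by simpa using hS2, fun i hi j hj => ?_, hasSmithForm_empty_cells hS2 _⟩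
    simp only [pathNum_empty_cells hS2 hi hj, pathNum_empty_cells hS2 hj hi, eq_comm]
  | succ N ih =>
    obtain ⟨c, hc, a, ha, b, hb, hcab, hother⟩ := hT.exists_extremal_cell hcard
      (Finset.card_pos.1 (by omega))
    have hab : a < b := by
      refine lt_of_le_of_ne (hcab a ha).2 fun hab => ?_
      have : c ⊆ {a} := fun x hx => by
        have := hcab x hx
        rw [Finset.mem_singleton]
        exact le_antisymm (hab ▸ this.2) this.1
      have := Finset.card_le_card this
      rw [(hcard c hc).2, Finset.card_singleton] at this
      omega
    obtain ⟨E, hE⟩ : ∃ E, E = S.filter fun x => a < x ∧ x < b := ⟨_, rfl⟩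
    have hES : E ⊆ S := hE ▸ Finset.filter_subset _ _
    have hcE : c ⊆ insert a (insert b E) := fun x hx => by
      have := hcab x hx
      have := (hcard c hc).1 hx
      simp only [hE, Finset.mem_insert, Finset.mem_filter]
      grind
    have haE : a ∉ E := by simp [hE]
    have hbE : b ∉ E := by simp [hE]
    have habE : (insert a (insert b E)).card = E.card + 2 := by
      rw [Finset.card_insert_of_notMem, Finset.card_insert_of_notMem hbE]
      simp [haE, hab.ne]
    have haS : a ∈ S \ E := Finset.mem_sdiff.2 ⟨(hcard c hc).1 ha, haE⟩
    have hbS : b ∈ S \ E := Finset.mem_sdiff.2 ⟨(hcard c hc).1 hb, hbE⟩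
    have hS' : (S \ E).card + E.card = S.card := Finset.card_sdiff_add_card_eq_card hES
    have hNT : (T.erase c).card = N := by rw [Finset.card_erase_of_mem hc]; omega
    have hEe : e ≤ E.card := by
      have := Finset.card_le_card hcE
      rw [(hcard c hc).2, habE] at this
      omega
    have hdisj : ∀ c' ∈ T.erase c, Disjoint c' E := fun c' hc' =>
      Finset.disjoint_left.2 fun x hx hxE => by
        have := hother c' (Finset.mem_of_mem_erase hc') (Finset.ne_of_mem_erase hc') x hx
        simp only [hE, Finset.mem_filter] at hxE
        grind
    have hle' : S.card ≤ N * e + e + 2 := by rw [hN] at hle; linarith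
    obtain ⟨ih1, ih2, ih3⟩ := ih (T := T.erase c) (S := S \ E)
      (fun c₁ h₁ c₂ h₂ => hT c₁ (Finset.mem_of_mem_erase h₁) c₂ (Finset.mem_of_mem_erase h₂))
      (fun c' hc' => ⟨Finset.subset_sdiff.2 ⟨(hcard c' (Finset.mem_of_mem_erase hc')).1,
        hdisj c' hc'⟩, (hcard c' (Finset.mem_of_mem_erase hc')).2⟩)
      (by
        rw [← Finset.card_pair hab.ne]
        exact Finset.card_le_card (by grind))
      (by rw [hNT]; omega) hNT
    have hEcard : E.card = e := by omega
    have hceq : c = insert a (insert b E) :=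
      Finset.eq_of_subset_of_card_le hcE (by rw [habE, (hcard c hc).2, hEcard])
    have hear : IsEar e (T.erase c) (S \ E) E a b :=
      { lt := hab
        left_mem := haS
        right_mem := hbS
        between := fun x hx => by
          rw [hE] at hx
          exact (Finset.mem_filter.1 hx).2
        outside := fun x hx => by
          simp only [hE, Finset.mem_sdiff, Finset.mem_filter] at hx
          grind
        card_ear := hEcard
        pos := he
        disjoint := hdisj
        card_cells := by rw [hNT]; exact ih1 }
    have hTi : insert (insert a (insert b E)) (T.erase c) = T := by
      rw [← hceq, Finset.insert_erase hc]
    have hSi : S \ E ∪ E = S := Finset.sdiff_union_of_subset hES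
    refine ⟨?_, fun i hi j hj => ?_, ?_⟩
    · rw [add_mul, one_mul]
      omega
    · have := hear.pathNum_comm ih2 (i := i) (j := j) (by rwa [hSi]) (by rwa [hSi])
      rwa [hTi, hSi] at this
    · have := hear.hasSmithForm (ih2 a haS b hbS) (hNT.symm ▸ ih3)
      rwa [hTi, hSi, hNT] at this

end Arcs

/-- The linear order on the vertices obtained by cutting the polygon at the side joining the last
vertex to vertex `0`. -/
local instance vertexOrder (n : ℕ) [NeZero n] : LinearOrder (ZMod n) :=
  { PartialOrder.lift ZMod.val (ZMod.val_injective n) with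
    le_total := fun a b => le_total a.val b.val
    toDecidableLE := fun a b => inferInstanceAs (Decidable (a.val ≤ b.val))
    toDecidableEq := ZMod.decidableEq n }

lemma vertex_lt_iff {n : ℕ} [NeZero n] {u v : ZMod n} : u < v ↔ u.val < v.val := Iff.rfl

lemma vertex_le_iff {n : ℕ} [NeZero n] {u v : ZMod n} : u ≤ v ↔ u.val ≤ v.val := Iff.rfl

lemma val_sub_sub_one {n : ℕ} [NeZero n] (i v : ZMod n) :
    (v - i - 1).val = if i.val < v.val then v.val - i.val - 1 else v.val + n - i.val - 1 := by
  have hi := ZMod.val_lt i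
  have hv := ZMod.val_lt v
  split_ifs with h
  · have : v - i - 1 = ((v.val - i.val - 1 : ℕ) : ZMod n) := by
      rw [Nat.cast_sub (by omega), Nat.cast_sub (by omega)]
      simp
    rw [this, ZMod.val_natCast_of_lt (by omega)]
  · have : v - i - 1 = ((v.val + n - i.val - 1 : ℕ) : ZMod n) := by
      rw [Nat.cast_sub (by omega), Nat.cast_sub (by omega), Nat.cast_add]
      simp
    rw [this, ZMod.val_natCast_of_lt (by omega)]

lemma mem_arc_univ_iff {n : ℕ} [NeZero n] (i j v : ZMod n) :
    v ∈ arc Finset.univ i j ↔ (v - i - 1).val < pathLen n i j := by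
  have hi := ZMod.val_lt i
  have hj := ZMod.val_lt j
  have hv := ZMod.val_lt v
  rw [pathLen, val_sub_sub_one, val_sub_sub_one]
  simp only [mem_arc, Finset.mem_univ, true_and, vertex_lt_iff, vertex_le_iff]
  split_ifs <;> omega

lemma dPathCount_eq_pathNum {n : ℕ} [NeZero n] (d : ℕ) (T : Finset (Finset (ZMod n)))
    (i j : ZMod n) :
    dPathCount n d T i j = pathNum (d - 2) T Finset.univ i j := by
  have hpos : ∀ l : ℕ, l < pathLen n i j → (i + 1 + (l : ZMod n) - i - 1).val = l := by
    intro l hl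
    have : i + 1 + (l : ZMod n) - i - 1 = (l : ZMod n) := by ring
    rw [this, ZMod.val_natCast_of_lt (hl.trans (ZMod.val_lt _))]
  have hinv : ∀ v : ZMod n, i + 1 + (((v - i - 1).val : ℕ) : ZMod n) = v := by
    intro v
    rw [ZMod.natCast_zmod_val]
    ring
  have harc := mem_arc_univ_iff i j
  have hmem : ∀ l : Fin (pathLen n i j), i + 1 + ((l : ℕ) : ZMod n) ∈ arc Finset.univ i j :=
    fun l => by rw [harc, hpos l l.2]; exact l.2
  have hcount : ∀ (f : ZMod n → Finset (ZMod n)) (c : Finset (ZMod n)),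
      ((arc Finset.univ i j).filter fun v => f v = c).card =
        (Finset.univ.filter fun l : Fin (pathLen n i j) =>
          f (i + 1 + ((l : ℕ) : ZMod n)) = c).card := by
    intro f c
    symm
    refine Finset.card_bij (fun l _ => i + 1 + ((l : ℕ) : ZMod n)) ?_ ?_ ?_
    · intro l hl
      exact Finset.mem_filter.2 ⟨hmem l, (Finset.mem_filter.1 hl).2⟩
    · intro l _ l' _ h
      have h' := congrArg (fun v : ZMod n => (v - i - 1).val) h
      simp only [hpos l l.2, hpos l' l'.2] at h'
      exact Fin.ext h'
    · intro v hv
      rw [Finset.mem_filter] at hv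
      refine ⟨⟨(v - i - 1).val, (harc v).1 hv.1⟩, ?_, hinv v⟩
      simp only [Finset.mem_filter, Finset.mem_univ, true_and, hinv v, hv.2]
  let Φ : {q : Fin (pathLen n i j) → {c // c ∈ T} // IsDPath n d T i j q} →
      (ZMod n → Finset (ZMod n)) := fun q v =>
    if h : (v - i - 1).val < pathLen n i j then (q.1 ⟨(v - i - 1).val, h⟩ : Finset (ZMod n)) else ∅
  have hΦ : ∀ q (l : Fin (pathLen n i j)), Φ q (i + 1 + ((l : ℕ) : ZMod n)) = q.1 l := by
    intro q l
    simp only [Φ, hpos l l.2, l.2, dite_true]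
  have hΦmem : ∀ q, Φ q ∈ cellAssignments (d - 2) T (arc Finset.univ i j) := by
    intro q
    rw [mem_cellAssignments]
    refine ⟨fun v hv => ?_, fun v hv => ?_, fun c hc => ?_⟩
    · rw [harc] at hv
      have := q.2.1 ⟨(v - i - 1).val, hv⟩
      rw [hinv] at this
      simp only [Φ, hv, dite_true]
      exact ⟨(q.1 _).2, this⟩
    · rw [harc] at hv
      simp only [Φ, hv, dite_false]
    · rw [hcount]
      simp only [hΦ]
      exact q.2.2 c hc
  rw [dPathCount, pathNum, ← Fintype.card_coe, ← Nat.card_eq_fintype_card]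
  refine Nat.card_eq_of_bijective (fun q => ⟨Φ q, hΦmem q⟩) ⟨fun q q' h => ?_, fun f => ?_⟩
  · refine Subtype.ext (funext fun l => Subtype.ext ?_)
    rw [← hΦ, ← hΦ, Subtype.mk.inj h]
  · obtain ⟨h1, h2, h3⟩ := mem_cellAssignments.1 f.2
    refine ⟨⟨fun l => ⟨f.1 (i + 1 + ((l : ℕ) : ZMod n)), (h1 _ (hmem l)).1⟩,
      fun l => (h1 _ (hmem l)).2, fun c hc => ?_⟩, ?_⟩
    · rw [← hcount]
      exact h3 c hc
    · refine Subtype.ext (funext fun v => ?_)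
      by_cases hv : (v - i - 1).val < pathLen n i j
      · simp only [Φ, hv, dite_true, hinv]
      · simp only [Φ, hv, dite_false]
        exact (h2 v (by rwa [harc])).symm

lemma card_interior_vertices_le {n d : ℕ} [NeZero n] (hd : 3 ≤ d) {T : Finset (Finset (ZMod n))}
    (hT : IsDAngulation n d T) : n ≤ T.card * (d - 2) + 2 := by
  by_cases hn : n ≤ 2
  · omega
  let z : ZMod n := 0
  let l : ZMod n := ((n - 1 : ℕ) : ZMod n)
  have hz : z.val = 0 := ZMod.val_zero
  have hl : l.val = n - 1 := ZMod.val_natCast_of_lt (by omega)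
  have hcover : (Finset.univ.erase z).erase l ⊆
      T.biUnion fun c => c.filter fun v => (∃ u ∈ c, u < v) ∧ ∃ w ∈ c, v < w := by
    intro v hv
    simp only [Finset.mem_erase, Finset.mem_univ, and_true] at hv
    have hvl : v.val ≠ l.val := fun h => hv.1 (ZMod.val_injective n h)
    have hvz : v.val ≠ z.val := fun h => hv.2 (ZMod.val_injective n h)
    have := ZMod.val_lt v
    obtain ⟨c, hc, hvc, hu, hw⟩ := exists_cell_around hT hz (l := l) (by omega)
      (show z.val < v.val by omega) (by omega)
    simp only [Finset.mem_biUnion, Finset.mem_filter]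
    exact ⟨c, hc, hvc, hu, hw⟩
  have h1 := (Finset.card_le_card hcover).trans
    (Finset.card_biUnion_le_card_mul T _ (d - 2) fun c hc => ?_)
  · have hlz : l ≠ z := fun h => by rw [h] at hl; omega
    rw [Finset.card_erase_of_mem (by simp [hlz]), Finset.card_erase_of_mem (Finset.mem_univ z),
      Finset.card_univ, ZMod.card] at h1
    omega
  · have hcard := hT.1 c hc
    have hcne : c.Nonempty := Finset.card_pos.1 (by omega)
    have hlt : c.min' hcne < c.max' hcne := c.min'_lt_max'_of_card (by omega)
    have hsub : (c.filter fun v => (∃ u ∈ c, u < v) ∧ ∃ w ∈ c, v < w) ⊆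
        (c.erase (c.min' hcne)).erase (c.max' hcne) := by
      intro v hv
      simp only [Finset.mem_filter] at hv
      obtain ⟨hvc, ⟨u, hu, huv⟩, w, hw, hvw⟩ := hv
      simp only [Finset.mem_erase]
      exact ⟨(hvw.trans_le (c.le_max' w hw)).ne, ((c.min'_le u hu).trans_lt huv).ne', hvc⟩
    refine (Finset.card_le_card hsub).trans ?_
    rw [Finset.card_erase_of_mem (Finset.mem_erase.2 ⟨hlt.ne', c.max'_mem hcne⟩),
      Finset.card_erase_of_mem (c.min'_mem hcne), hcard]
    omega

lemma IsDAngulation.noncrossing {n d : ℕ} [NeZero n] (hd : 3 ≤ d) {T : Finset (Finset (ZMod n))}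
    (hT : IsDAngulation n d T) : Noncrossing T :=
  fun _ hc _ hc' hne _ hp _ hq _ hr _ hs hpq hqr hrs =>
    not_crossing hd hT hc hc' hne hp hq hr hs hpq hqr hrs

/-- Smith normal form of the matrix of `d`-path numbers of any `d`-angulation `T`
of the convex `n`-gon, `n = d + m * (d - 2)`: the elementary divisors are `d - 1`
with multiplicity `m + 1`, and all remaining ones are `1`, independently of the
particular `d`-angulation. -/
theorem snf_dPathMatrix (d m n : ℕ) (hd : 3 ≤ d) (hn : n = d + m * (d - 2))
    (T : Finset (Finset (ZMod n))) (hT : IsDAngulation n d T) :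
    ∃ U V : Matrix (Fin n) (Fin n) ℤ, IsUnit U.det ∧ IsUnit V.det ∧
      U * (Matrix.of fun i j : Fin n =>
            (dPathCount n d T ((i : ℕ) : ZMod n) ((j : ℕ) : ZMod n) : ℤ)) * V
        = Matrix.diagonal
            (fun i : Fin n => if (i : ℕ) < n - (m + 1) then (1 : ℤ) else (d - 1)) := by
  have : NeZero n := ⟨by omega⟩
  obtain ⟨hcard, -, hsnf⟩ := (hT.noncrossing hd).hasSmithForm (e := d - 2) (S := Finset.univ)
    (by omega) (fun c hc => ⟨Finset.subset_univ c, by rw [hT.1 c hc]; omega⟩)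
    (by rw [Finset.card_univ, ZMod.card]; omega)
    (by rw [Finset.card_univ, ZMod.card]; exact card_interior_vertices_le hd hT)
  rw [Finset.card_univ, ZMod.card] at hcard
  have hTm : T.card = m + 1 := by
    have : T.card * (d - 2) = (m + 1) * (d - 2) := by
      rw [add_mul, one_mul]
      omega
    exact Nat.eq_of_mul_eq_mul_right (by omega) this
  have hdx : ((d - 2 : ℕ) : ℤ) + 1 = d - 1 := by omega
  rw [hTm, hdx] at hsnf
  let φ : Fin n ≃ (Finset.univ : Finset (ZMod n)) :=
    { toFun := fun i => ⟨((i : ℕ) : ZMod n), Finset.mem_univ _⟩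
      invFun := fun v => ⟨(v : ZMod n).val, ZMod.val_lt _⟩
      left_inv := fun i => Fin.ext (ZMod.val_natCast_of_lt i.2)
      right_inv := fun v => Subtype.ext (ZMod.natCast_zmod_val _) }
  have hsnf' := hsnf.submatrix φ
  have hmat : (Matrix.of fun i j : Fin n =>
      (dPathCount n d T ((i : ℕ) : ZMod n) ((j : ℕ) : ZMod n) : ℤ)) =
      (Matrix.of fun i j : (Finset.univ : Finset (ZMod n)) =>
        (pathNum (d - 2) T Finset.univ (i : ZMod n) j : ℤ)).submatrix φ φ := by
    ext i j
    simp [φ, dPathCount_eq_pathNum d T]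
  rw [hmat]
  refine hsnf'.exists_diagonal (fun i : Fin n => (i : ℕ) < n - (m + 1)) ?_
  have hmn : m + 1 ≤ n := by
    have : m * 1 ≤ m * (d - 2) := Nat.mul_le_mul_left m (by omega)
    omega
  have hc1 := Finset.card_filter_add_card_filter_not (s := (Finset.univ : Finset (Fin n)))
    (fun i : Fin n => (i : ℕ) < n - (m + 1))
  rw [Fin.card_filter_val_lt, Finset.card_univ, Fintype.card_fin] at hc1
  omega
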